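/- Let k ≥ 2, let S ⊆ 𝔽₂^k be a coset of a 2-dimensional linear subspace of 𝔽₂^k, and let ε : S → {+1, −1} be a sign assignment such that the number of points of S with ε = +1 is odd. Then there exists a Boolean function g : 𝔽₂^k → 𝔽₂ whose Walsh transform satisfies W_g(y) = ε(y) · 2^{k−1} for y ∈ S and W_g(y) = 0 for y ∉ S. -/

import Mathlib

/-- `𝔽₂ⁿ`, the space of binary vectors of length `n`. -/
abbrev BV (n : ℕ) : Type := Fin n → ZMod 2

/-- The inner product `⟨x, y⟩ = ⊕ᵢ xᵢ yᵢ` on `𝔽₂ⁿ`. -/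
def ip {n : ℕ} (x y : BV n) : ZMod 2 := ∑ i, x i * y i

/-- The Walsh transform `W_f(y) = ∑_{x} (−1)^{f(x) ⊕ ⟨x,y⟩}` of a Boolean function. -/
def walsh {n : ℕ} (f : BV n → ZMod 2) (y : BV n) : ℤ :=
  ∑ x : BV n, (-1 : ℤ) ^ ((f x + ip x y).val)

/-- A Boolean function in `n` variables (`n` even) is bent if `|W_f(y)| = 2^{n/2}`
for all `y`. -/
def IsBent (n : ℕ) (f : BV n → ZMod 2) : Prop :=
  ∀ y : BV n, |walsh f y| = 2 ^ (n / 2)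

/-- `b_n`, the number of bent functions in `n` variables. -/
noncomputable def bentCount (n : ℕ) : ℕ :=
  Nat.card {f : BV n → ZMod 2 // IsBent n f}

/-- `S` is a coset of a 2-dimensional linear subspace of `𝔽₂^k`. -/
def IsCoset2 {k : ℕ} (S : Set (BV k)) : Prop :=
  ∃ W : Submodule (ZMod 2) (BV k), Module.finrank (ZMod 2) W = 2 ∧
    ∃ a : BV k, S = {v | ∃ w ∈ W, v = a + w}

/-- The sign character `z ↦ (-1)^z` of `𝔽₂` is multiplicative. -/
lemma neg_one_pow_val_add (a b : ZMod 2) :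
    (-1 : ℤ) ^ (a + b).val = (-1) ^ a.val * (-1) ^ b.val := by
  revert a b
  decide

lemma neg_one_pow_val_eq (a : ZMod 2) : (-1 : ℤ) ^ a.val = 1 ∨ (-1 : ℤ) ^ a.val = -1 :=
  neg_one_pow_eq_or ℤ a.val

lemma ip_add_right {n : ℕ} (x y z : BV n) : ip x (y + z) = ip x y + ip x z := by
  simp [ip, mul_add, Finset.sum_add_distrib]

lemma ip_add_left {n : ℕ} (x y z : BV n) : ip (x + y) z = ip x z + ip y z := by
  simp [ip, add_mul, Finset.sum_add_distrib]

lemma BV.add_eq_zero_iff {n : ℕ} (x y : BV n) : x + y = 0 ↔ x = y := by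
  have h : ∀ a b : ZMod 2, a + b = 0 ↔ a = b := by decide
  simp only [funext_iff, Pi.add_apply, Pi.zero_apply, h]

/-- Orthogonality of the characters of `𝔽₂ⁿ`. -/
lemma sum_neg_one_pow_ip {n : ℕ} (z : BV n) :
    ∑ x : BV n, (-1 : ℤ) ^ (ip x z).val = if z = 0 then 2 ^ n else 0 := by
  split_ifs with hz
  · subst hz
    simp [ip, ZMod.card]
  · obtain ⟨i, hi⟩ := Function.ne_iff.mp hz
    have hzi : z i = 1 := by
      have h : ∀ a : ZMod 2, a ≠ 0 → a = 1 := by decide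
      exact h _ hi
    have hs : ip (Pi.single i 1) z = 1 := by
      simp [ip, Pi.single_apply, hzi]
    have h := Equiv.sum_comp (Equiv.addRight (Pi.single i 1 : BV n))
      (fun x => (-1 : ℤ) ^ (ip x z).val)
    simp only [Equiv.coe_addRight, ip_add_left, hs, neg_one_pow_val_add, ZMod.val_one, pow_one,
      mul_neg, mul_one, Finset.sum_neg_distrib] at h
    linarith

/-- If twice the sign function of `g` is `∑ s ∈ T, ε s (-1)^⟨x, s⟩`, then Fourier inversion gives
the Walsh transform of `g`. -/
lemma two_mul_walsh_of_expansion {n : ℕ} (T : Finset (BV n)) (ε : BV n → ℤ) (g : BV n → ZMod 2)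
    (hg : ∀ x, 2 * (-1 : ℤ) ^ (g x).val = ∑ s ∈ T, ε s * (-1) ^ (ip x s).val) (y : BV n) :
    2 * walsh g y = if y ∈ T then ε y * 2 ^ n else 0 := by
  calc 2 * walsh g y
      = ∑ x : BV n, ∑ s ∈ T, ε s * (-1 : ℤ) ^ (ip x (s + y)).val := by
        rw [walsh, Finset.mul_sum]
        refine Finset.sum_congr rfl fun x _ => ?_
        rw [neg_one_pow_val_add, ← mul_assoc, hg, Finset.sum_mul]
        refine Finset.sum_congr rfl fun s _ => ?_
        rw [ip_add_right, neg_one_pow_val_add, mul_assoc]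
    _ = ∑ s ∈ T, ε s * if s = y then 2 ^ n else 0 := by
        rw [Finset.sum_comm]
        refine Finset.sum_congr rfl fun s _ => ?_
        simp only [← Finset.mul_sum, sum_neg_one_pow_ip, BV.add_eq_zero_iff]
    _ = _ := by simp [mul_ite]

/-- Four signs with product `-1` sum to `±2`. -/
lemma sum_four_signs {a b c d : ℤ} (ha : a = 1 ∨ a = -1) (hb : b = 1 ∨ b = -1)
    (hc : c = 1 ∨ c = -1) (hd : d = 1 ∨ d = -1) (h : a * b * c * d = -1) :
    a + b + c + d = 2 ∨ a + b + c + d = -2 := by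
  rcases ha with rfl | rfl <;> rcases hb with rfl | rfl <;> rcases hc with rfl | rfl <;>
    rcases hd with rfl | rfl <;> simp_all

/-- Among four signs, an odd number equal to `1` forces the product to be `-1`. -/
lemma prod_four_signs {a b c d : ℤ} (ha : a = 1 ∨ a = -1) (hb : b = 1 ∨ b = -1)
    (hc : c = 1 ∨ c = -1) (hd : d = 1 ∨ d = -1)
    (h : Odd ((if a = 1 then 1 else 0) + ((if b = 1 then 1 else 0) +
      ((if c = 1 then 1 else 0) + if d = 1 then 1 else 0)) : ℕ)) :
    a * b * c * d = -1 := by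
  rcases ha with rfl | rfl <;> rcases hb with rfl | rfl <;> rcases hc with rfl | rfl <;>
    rcases hd with rfl | rfl <;> revert h <;> decide

/-- A coset of a plane of `𝔽₂ⁿ` consists of the four distinct points `a`, `a + u`, `a + v`,
`a + (u + v)`. -/
lemma IsCoset2.exists_points {n : ℕ} {S : Set (BV n)} (hS : IsCoset2 S) :
    ∃ a u v : BV n, u ≠ 0 ∧ v ≠ 0 ∧ u ≠ v ∧
      ∀ y, y ∈ S ↔ y = a ∨ y = a + u ∨ y = a + v ∨ y = a + (u + v) := by
  obtain ⟨W, hW, a, rfl⟩ := hS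
  let b := Module.finBasisOfFinrankEq (ZMod 2) W hW
  refine ⟨a, b 0, b 1, ?_, ?_, ?_, fun y => ⟨?_, ?_⟩⟩
  · simpa using b.ne_zero 0
  · simpa using b.ne_zero 1
  · simpa [Subtype.coe_inj] using b.injective.ne (zero_ne_one : (0 : Fin 2) ≠ 1)
  · rintro ⟨w, hw, rfl⟩
    have hr := congrArg Subtype.val (b.sum_repr ⟨w, hw⟩)
    simp only [Fin.sum_univ_two, Submodule.coe_add, Submodule.coe_smul] at hr
    have h2 : ∀ c : ZMod 2, c = 0 ∨ c = 1 := by decide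
    rw [← hr]
    rcases h2 (b.repr ⟨w, hw⟩ 0) with h0 | h0 <;> rcases h2 (b.repr ⟨w, hw⟩ 1) with h1 | h1 <;>
      simp [h0, h1]
  · rintro (rfl | rfl | rfl | rfl)
    · exact ⟨0, W.zero_mem, by simp⟩
    · exact ⟨_, (b 0).2, rfl⟩
    · exact ⟨_, (b 1).2, rfl⟩
    · exact ⟨_, W.add_mem (b 0).2 (b 1).2, rfl⟩

/-- given a coset `S` of a 2-dimensional linear subspace of `𝔽₂^k`
(`k ≥ 2`) and signs `ε : S → {+1,−1}` with an odd number of `+1`s, there is a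
Boolean function `g` with `W_g = ε · 2^{k−1}` on `S` and `W_g = 0` off `S`. -/
theorem stmt_12 (k : ℕ) (hk : 2 ≤ k) (S : Set (BV k)) (hS : IsCoset2 S)
    (ε : BV k → ℤ) (hε : ∀ y ∈ S, ε y = 1 ∨ ε y = -1)
    (hodd : Odd (Nat.card {y : BV k // y ∈ S ∧ ε y = 1})) :
    ∃ g : BV k → ZMod 2,
      (∀ y ∈ S, walsh g y = ε y * 2 ^ (k - 1)) ∧
      (∀ y ∉ S, walsh g y = 0) := by
  classical
  obtain ⟨a, u, v, hu, hv, huv, hmem⟩ := hS.exists_points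
  have huv' : u + v ≠ 0 := fun h => huv ((BV.add_eq_zero_iff u v).mp h)
  let T : Finset (BV k) := {a, a + u, a + v, a + (u + v)}
  have hT : ∀ y, y ∈ S ↔ y ∈ T := fun y => by simp [T, hmem]
  have hsum : ∀ {M : Type} [AddCommMonoid M] (f : BV k → M),
      ∑ s ∈ T, f s = f a + (f (a + u) + (f (a + v) + f (a + (u + v)))) := by
    intro M _ f
    have h1 : a ∉ ({a + u, a + v, a + (u + v)} : Finset (BV k)) := by simp [hu, hv, huv']
    have h2 : a + u ∉ ({a + v, a + (u + v)} : Finset (BV k)) := by simp [hv, huv]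
    have h3 : a + v ∉ ({a + (u + v)} : Finset (BV k)) := by simp [hu]
    rw [Finset.sum_insert h1, Finset.sum_insert h2, Finset.sum_insert h3, Finset.sum_singleton]
  have ha := hε a ((hmem _).mpr (by simp))
  have hau := hε (a + u) ((hmem _).mpr (by simp))
  have hav := hε (a + v) ((hmem _).mpr (by simp))
  have hauv := hε (a + (u + v)) ((hmem _).mpr (by simp))
  have hprod : ε a * ε (a + u) * ε (a + v) * ε (a + (u + v)) = -1 := by
    refine prod_four_signs ha hau hav hauv ?_
    have hcard : Nat.card {y : BV k // y ∈ S ∧ ε y = 1} = (T.filter fun y => ε y = 1).card :=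
      Nat.subtype_card _ fun y => by rw [Finset.mem_filter, hT]
    rwa [hcard, Finset.card_filter, hsum] at hodd
  have hsign : ∀ {e : ℤ} (c : ZMod 2), (e = 1 ∨ e = -1) →
      (e * (-1) ^ c.val = 1 ∨ e * (-1) ^ c.val = -1) := by
    intro e c he
    rcases he with rfl | rfl <;> rcases neg_one_pow_val_eq c with h | h <;> simp [h]
  have htwo : ∀ x, (∑ s ∈ T, ε s * (-1) ^ (ip x s).val = 2) ∨
      (∑ s ∈ T, ε s * (-1) ^ (ip x s).val = -2) := by
    intro x
    rw [hsum, ← add_assoc, ← add_assoc]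
    refine sum_four_signs (hsign _ ha) (hsign _ hau) (hsign _ hav) (hsign _ hauv) ?_
    refine Eq.trans ?_ hprod
    simp only [ip_add_right, neg_one_pow_val_add]
    rcases neg_one_pow_val_eq (ip x a) with h | h <;>
      rcases neg_one_pow_val_eq (ip x u) with h' | h' <;>
      rcases neg_one_pow_val_eq (ip x v) with h'' | h'' <;> rw [h, h', h''] <;> ring
  let g : BV k → ZMod 2 := fun x => if ∑ s ∈ T, ε s * (-1) ^ (ip x s).val = 2 then 0 else 1
  have hg : ∀ x, 2 * (-1 : ℤ) ^ (g x).val = ∑ s ∈ T, ε s * (-1) ^ (ip x s).val := by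
    intro x
    rcases htwo x with h | h <;> simp [g, h, ZMod.val_one]
  have hpow : (2 : ℤ) ^ k = 2 * 2 ^ (k - 1) := by
    rw [← pow_succ', Nat.sub_add_cancel (by omega)]
  refine ⟨g, fun y hy => ?_, fun y hy => ?_⟩
  · have h := two_mul_walsh_of_expansion T ε g hg y
    rw [if_pos ((hT y).mp hy), hpow] at h
    linarith
  · have h := two_mul_walsh_of_expansion T ε g hg y
    rw [if_neg (mt (hT y).mpr hy)] at h
    linarith
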